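/- Let X be a finite set of points in P^1 × P^n, let X = X_1 ∪ ... ∪ X_t be its decomposition into level sets with respect to η_1, and suppose X satisfies the hypotheses: the points of π_1(A_X) and π_1(B_X) are generic in P^n, Y_i ∩ Y_j ⊆ B_Y for i ≠ j, and A_t(X) = X_t ∩ A_X = ∅. Then I_{X_t} = (L_t) + I_W, where L_t ∈ k[x_0,x_1] is the linear form defining η_1(X_t) ∈ P^1 and I_W ⊆ k[y_0,...,y_n] ⊆ R is the vanishing ideal of π_1(B_X) ⊂ P^n extended to R; in particular I_{X'} + I_{X_t} ⊇ I_W for X' = X_1 ∪ ... ∪ X_{t-1}. -/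

import Mathlib

noncomputable section

/-- Points of projective `m`-space over the field `k`. -/
abbrev Pt (k : Type) [Field k] (m : ℕ) := Projectivization k (Fin (m + 1) → k)

set_option synthInstance.maxHeartbeats 1000000 in
/-- An ideal `I` of a polynomial ring defines an *arithmetically Cohen–Macaulay* (ACM)
quotient if there is a regular sequence on `R/I`, consisting of elements of the irrelevant
maximal ideal (generated by the images of the variables), whose length equals the Krull
dimension of `R/I`.  For a graded quotient of a polynomial ring this says exactly that the
depth of the irrelevant maximal ideal on `R/I` equals the Krull dimension, i.e. that `R/I`
is a Cohen–Macaulay ring. -/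
def IsACM {k : Type} [Field k] {σ : Type} (I : Ideal (MvPolynomial σ k)) : Prop :=
  ∃ rs : List (MvPolynomial σ k ⧸ I),
    (∀ r ∈ rs,
      r ∈ Ideal.map (Ideal.Quotient.mk I)
            (Ideal.span (Set.range (MvPolynomial.X : σ → MvPolynomial σ k)))) ∧
    RingTheory.Sequence.IsRegular (MvPolynomial σ k ⧸ I) rs ∧
    (rs.length : WithBot ℕ∞) = ringKrullDim (MvPolynomial σ k ⧸ I)

variable (k : Type) [Field k]

/-- The homogeneous (saturated) vanishing ideal of a set of points of `ℙ^m`: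
all polynomials vanishing on the affine cone over the points. -/
def vanishP {m : ℕ} (Z : Set (Pt k m)) : Ideal (MvPolynomial (Fin (m + 1)) k) :=
  ⨅ (q : Pt k m) (_ : q ∈ Z) (s : k),
    RingHom.ker (MvPolynomial.eval (s • q.rep))

/-- The bihomogeneous (saturated) vanishing ideal of a set of points of `ℙ^a × ℙ^b`:
all polynomials vanishing on the multicone over the points. -/
def vanishP2 {a b : ℕ} (X : Set (Pt k a × Pt k b)) :
    Ideal (MvPolynomial (Fin (a + 1) ⊕ Fin (b + 1)) k) :=
  ⨅ (p : Pt k a × Pt k b) (_ : p ∈ X) (s : k) (t : k),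
    RingHom.ker (MvPolynomial.eval (Sum.elim (s • p.1.rep) (t • p.2.rep)))

/-- The `(⋆)`-property for a finite set of points in `ℙ^a × ℙ^b`. -/
def StarProp {a b : ℕ} (X : Set (Pt k a × Pt k b)) : Prop :=
  ∀ p ∈ X, ∀ q ∈ X, (p.1, q.2) ∈ X ∨ (q.1, p.2) ∈ X

/-- The Hilbert function of the quotient by an ideal `I` of a polynomial ring:
`i ↦ dim_k S_i − dim_k (I ∩ S_i)`. -/
def hilbFn {σ : Type} (I : Ideal (MvPolynomial σ k)) (i : ℕ) : ℕ :=
  Module.finrank k (MvPolynomial.homogeneousSubmodule σ k i) -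
  Module.finrank k
    ((Submodule.restrictScalars k I ⊓ MvPolynomial.homogeneousSubmodule σ k i :
      Submodule k (MvPolynomial σ k)))

/-- A set of points of `ℙ^m` has generic Hilbert function:
`H_Z(i) = min (C(i+m,m), #Z)` for all `i`. -/
def GenericHF {m : ℕ} (Z : Set (Pt k m)) : Prop :=
  ∀ i : ℕ, hilbFn k (vanishP k Z) i = min (Nat.choose (i + m) m) Z.ncard

/-- The image in `ℙ^n` of the level set of `X ⊆ ℙ^1 × ℙ^n` over the point `P ∈ ℙ^1`;
this is the set `Y_i = π₁(X_i)` when `P = P_i` is in the image of the first projection. -/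
def levelImage {n : ℕ} (X : Set (Pt k 1 × Pt k n)) (P : Pt k 1) : Set (Pt k n) :=
  {q | (P, q) ∈ X}

/-- `X ⊆ ℙ^1 × ℙ^n` has the *inclusion property*: the images `Y_1, …, Y_t` of its level
sets are totally ordered by inclusion. -/
def InclusionProp {n : ℕ} (X : Set (Pt k 1 × Pt k n)) : Prop :=
  ∀ P₁ P₂ : Pt k 1,
    levelImage k X P₁ ⊆ levelImage k X P₂ ∨ levelImage k X P₂ ⊆ levelImage k X P₁

/-- `B_Y ⊆ ℙ^n`: the points lying in the image of every level set of `X`,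
i.e. `B_Y = ⋂ᵢ Y_i`. -/
def BY {n : ℕ} (X : Set (Pt k 1 × Pt k n)) : Set (Pt k n) :=
  {q | ∀ P ∈ Prod.fst '' X, (P, q) ∈ X}

/-- `B_X`: the points `P × Q` of `X` with `Q ∈ ⋂ᵢ Y_i`. -/
def BX {n : ℕ} (X : Set (Pt k 1 × Pt k n)) : Set (Pt k 1 × Pt k n) :=
  {p ∈ X | p.2 ∈ BY k X}

/-- `A_X = X \ B_X`. -/
def AX {n : ℕ} (X : Set (Pt k 1 × Pt k n)) : Set (Pt k 1 × Pt k n) :=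
  X \ BX k X

/-- `N₀(X) = #π₁(A_X)`. -/
def N0 {n : ℕ} (X : Set (Pt k 1 × Pt k n)) : ℕ := (Prod.snd '' AX k X).ncard

/-- `N₁(X) = #π₁(B_X)`. -/
def N1 {n : ℕ} (X : Set (Pt k 1 × Pt k n)) : ℕ := (Prod.snd '' BX k X).ncard

/-- `𝒟(X) = ⋃_{i ∈ ℤ} {C(N₀(X)+i, n), C(N₀(X)+i, n)+1, …, C(N₀(X)+i+1, n) − N₀(X)}`
(written with `j = N₀(X) + i`). -/
def DX {n : ℕ} (X : Set (Pt k 1 × Pt k n)) : Set ℕ :=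
  {m | ∃ j : ℕ, Nat.choose j n ≤ m ∧ m + N0 k X ≤ Nat.choose (j + 1) n}

open MvPolynomial in
/-- A linear form in two variables is `a X₀ + b X₁` for some scalars `a`, `b`. -/
theorem exists_eq_of_isHomogeneous_one {L : MvPolynomial (Fin (1 + 1)) k}
    (hL : L.IsHomogeneous 1) : ∃ a b : k, L = C a * X 0 + C b * X 1 := by
  have h : L ∈ Submodule.span k (Set.range (X : Fin (1 + 1) → MvPolynomial (Fin (1 + 1)) k)) := by
    rw [← homogeneousSubmodule_one_eq_span_X]
    exact hL
  obtain ⟨c, hc⟩ := (Submodule.mem_span_range_iff_exists_fun k).1 h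
  refine ⟨c 0, c 1, ?_⟩
  rw [← hc, Fin.sum_univ_two, smul_eq_C_mul, smul_eq_C_mul]

open MvPolynomial in
/-- A nonzero linear form in two variables vanishing at `p` divides `p₀ X₁ - p₁ X₀`. -/
theorem dvd_of_eval_eq_zero {L : MvPolynomial (Fin (1 + 1)) k}
    (hL : L.IsHomogeneous 1) (hL0 : L ≠ 0) {p : Fin (1 + 1) → k} (hp : eval p L = 0) :
    L ∣ C (p 0) * X 1 - C (p 1) * X 0 := by
  obtain ⟨a, b, rfl⟩ := exists_eq_of_isHomogeneous_one k hL
  have hab : a * p 0 + b * p 1 = 0 := by simpa using hp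
  by_cases hb : b = 0
  · subst hb
    have ha : a ≠ 0 := by
      rintro rfl
      simp at hL0
    have hp0 : p 0 = 0 := by simpa [ha] using hab
    refine ⟨C (-p 1 / a), ?_⟩
    have h : (C a : MvPolynomial (Fin (1 + 1)) k) * C (-p 1 / a) = C (-p 1) := by
      rw [← C_mul, mul_div_cancel₀ _ ha]
    rw [hp0, C_0, add_mul, mul_right_comm, h, C_neg]
    ring
  · refine ⟨C (p 0 / b), ?_⟩
    have h1 : (C b : MvPolynomial (Fin (1 + 1)) k) * C (p 0 / b) = C (p 0) := by
      rw [← C_mul, mul_div_cancel₀ _ hb]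
    have h2 : (C a : MvPolynomial (Fin (1 + 1)) k) * C (p 0 / b) = C (-p 1) := by
      rw [← C_mul]
      congr 1
      field_simp
      linear_combination hab
    rw [add_mul, mul_right_comm, h2, mul_right_comm, h1, C_neg]
    ring

open MvPolynomial in
/-- For all `i j`, a nonzero linear form vanishing at `p` divides `p_j X_i - p_i X_j`. -/
theorem dvd_sub_of_eval_eq_zero {L : MvPolynomial (Fin (1 + 1)) k}
    (hL : L.IsHomogeneous 1) (hL0 : L ≠ 0) {p : Fin (1 + 1) → k} (hp : eval p L = 0)
    (i j : Fin (1 + 1)) : L ∣ C (p j) * X i - C (p i) * X j := by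
  have h := dvd_of_eval_eq_zero k hL hL0 hp
  have h' : L ∣ C (p 1) * X 0 - C (p 0) * X 1 := by
    rw [← neg_sub]
    exact (dvd_neg).2 h
  change Fin 2 at i j
  fin_cases i <;> fin_cases j <;> simp <;> first | exact h | exact h'

theorem mem_vanishP {m : ℕ} {Z : Set (Pt k m)} {f : MvPolynomial (Fin (m + 1)) k} :
    f ∈ vanishP k Z ↔ ∀ q ∈ Z, ∀ s : k, MvPolynomial.eval (s • q.rep) f = 0 := by
  simp [vanishP, RingHom.mem_ker]

theorem mem_vanishP2 {a b : ℕ} {X : Set (Pt k a × Pt k b)}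
    {f : MvPolynomial (Fin (a + 1) ⊕ Fin (b + 1)) k} :
    f ∈ vanishP2 k X ↔ ∀ p ∈ X, ∀ s t : k,
      MvPolynomial.eval (Sum.elim (s • p.1.rep) (t • p.2.rep)) f = 0 := by
  simp only [vanishP2, Ideal.mem_iInf, RingHom.mem_ker]

/-- Restriction of polynomials on `ℙ^a × ℙ^b` to the multicone over `{p} × ℙ^b`. -/
def restrictFiber {a b : ℕ} (p : Fin (a + 1) → k) :
    MvPolynomial (Fin (a + 1) ⊕ Fin (b + 1)) k →ₐ[k]
      Polynomial (MvPolynomial (Fin (b + 1)) k) :=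
  MvPolynomial.aeval (Sum.elim
    (fun i => Polynomial.C (MvPolynomial.C (p i)) * Polynomial.X)
    (fun j => Polynomial.C (MvPolynomial.X j)))

theorem eval_map_restrictFiber {a b : ℕ} (p : Fin (a + 1) → k) (v : Fin (b + 1) → k) (s : k)
    (f : MvPolynomial (Fin (a + 1) ⊕ Fin (b + 1)) k) :
    ((restrictFiber k p f).map (MvPolynomial.eval v)).eval s =
      MvPolynomial.eval (Sum.elim (s • p) v) f := by
  induction f using MvPolynomial.induction_on with
  | C c =>
    simp [restrictFiber, Polynomial.algebraMap_apply, MvPolynomial.algebraMap_eq]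
  | add f g hf hg => simp [hf, hg]
  | mul_X f i hf =>
    rw [map_mul, Polynomial.map_mul, Polynomial.eval_mul, hf, map_mul]
    congr 1
    cases i with
    | inl i =>
      simp only [restrictFiber, MvPolynomial.aeval_X, Sum.elim_inl, MvPolynomial.eval_X,
        Polynomial.map_mul, Polynomial.map_C, Polynomial.map_X, MvPolynomial.eval_C,
        Polynomial.eval_mul, Polynomial.eval_C, Polynomial.eval_X, Pi.smul_apply, smul_eq_mul]
      exact mul_comm _ _
    | inr j => simp [restrictFiber]

/-- Every coefficient of the restriction to a fiber of a form vanishing on `{P} × Y`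
vanishes on `Y`. -/
theorem coeff_restrictFiber_mem [Infinite k] {a b : ℕ} {P : Pt k a}
    {Z : Set (Pt k a × Pt k b)} {Y : Set (Pt k b)} (hY : ∀ q ∈ Y, (P, q) ∈ Z)
    {f : MvPolynomial (Fin (a + 1) ⊕ Fin (b + 1)) k} (hf : f ∈ vanishP2 k Z) (m : ℕ) :
    (restrictFiber k P.rep f).coeff m ∈ vanishP k Y := by
  rw [mem_vanishP]
  intro q hq t
  have h : (restrictFiber k P.rep f).map (MvPolynomial.eval (t • q.rep)) = 0 := by
    refine Polynomial.funext fun s => ?_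
    rw [eval_map_restrictFiber, Polynomial.eval_zero]
    exact (mem_vanishP2 k).1 hf _ (hY q hq) s t
  rw [← Polynomial.coeff_map, h, Polynomial.coeff_zero]

/-- Substituting `r` for the parameter of the cone over a point turns restriction to the fiber
over `p` into the identity modulo any ideal containing all `x_i - p_i r`. -/
theorem eval₂_restrictFiber_sub_mem {a b : ℕ} {p : Fin (a + 1) → k}
    {I : Ideal (MvPolynomial (Fin (a + 1) ⊕ Fin (b + 1)) k)}
    {r : MvPolynomial (Fin (a + 1) ⊕ Fin (b + 1)) k}
    (h : ∀ i, MvPolynomial.C (p i) * r - MvPolynomial.X (Sum.inl i) ∈ I)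
    (f : MvPolynomial (Fin (a + 1) ⊕ Fin (b + 1)) k) :
    (restrictFiber k p f).eval₂
      (MvPolynomial.rename Sum.inr : MvPolynomial (Fin (b + 1)) k →ₐ[k]
        MvPolynomial (Fin (a + 1) ⊕ Fin (b + 1)) k).toRingHom r - f ∈ I := by
  induction f using MvPolynomial.induction_on with
  | C c =>
    simp [restrictFiber, Polynomial.algebraMap_apply, MvPolynomial.algebraMap_eq]
  | add f g hf hg =>
    rw [map_add, Polynomial.eval₂_add, add_sub_add_comm]
    exact I.add_mem hf hg
  | mul_X f i hf =>
    rw [map_mul, Polynomial.eval₂_mul]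
    refine Ideal.mul_sub_mul_mem I hf ?_
    cases i with
    | inl i => simpa [restrictFiber] using h i
    | inr j => simp [restrictFiber]

/-- The ideal of `{P} × Y` is generated by a linear form defining `P ∈ ℙ^1` and the
ideal of `Y`. -/
theorem vanishP2_fiber [Infinite k] {n : ℕ} {P : Pt k 1} {Z : Set (Pt k 1 × Pt k n)}
    {Y : Set (Pt k n)} (hZ : ∀ p, p ∈ Z ↔ p.1 = P ∧ p.2 ∈ Y)
    {L : MvPolynomial (Fin (1 + 1)) k} (hL1 : L.IsHomogeneous 1) (hL0 : L ≠ 0)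
    (hLv : ∀ s : k, MvPolynomial.eval (s • P.rep) L = 0) :
    vanishP2 k Z =
      Ideal.span
          {MvPolynomial.rename (Sum.inl : Fin (1 + 1) → Fin (1 + 1) ⊕ Fin (n + 1)) L} +
        Ideal.map (MvPolynomial.rename (Sum.inr : Fin (n + 1) → Fin (1 + 1) ⊕ Fin (n + 1)))
          (vanishP k Y) := by
  apply le_antisymm
  · intro f hf
    obtain ⟨j, hj⟩ := Function.ne_iff.1 P.rep_nonzero
    have hj : P.rep j ≠ 0 := hj
    have hp : MvPolynomial.eval P.rep L = 0 := by simpa using hLv 1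
    have hmem := eval₂_restrictFiber_sub_mem k (p := P.rep)
      (I := Ideal.span
        {MvPolynomial.rename (Sum.inl : Fin (1 + 1) → Fin (1 + 1) ⊕ Fin (n + 1)) L})
      (r := MvPolynomial.C (P.rep j)⁻¹ * MvPolynomial.X (Sum.inl j)) (fun i => by
        rw [Ideal.mem_span_singleton]
        have h := map_dvd (MvPolynomial.rename
          (Sum.inl : Fin (1 + 1) → Fin (1 + 1) ⊕ Fin (n + 1)))
          (dvd_sub_of_eval_eq_zero k hL1 hL0 hp j i)
        refine (h.mul_left (MvPolynomial.C (P.rep j)⁻¹)).trans (dvd_of_eq ?_)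
        have hc : (MvPolynomial.C (P.rep j)⁻¹ * MvPolynomial.C (P.rep j) :
            MvPolynomial (Fin (1 + 1) ⊕ Fin (n + 1)) k) = 1 := by
          rw [← MvPolynomial.C_mul, inv_mul_cancel₀ hj, MvPolynomial.C_1]
        simp only [map_sub, map_mul, MvPolynomial.rename_C, MvPolynomial.rename_X]
        linear_combination (-MvPolynomial.X (Sum.inl i)) * hc) f
    rw [← sub_sub_cancel ((restrictFiber k P.rep f).eval₂ _ _) f, sub_eq_neg_add]
    refine Submodule.add_mem_sup (neg_mem hmem) ?_
    rw [Polynomial.eval₂_eq_sum, Polynomial.sum]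
    exact Ideal.sum_mem _ fun m _ => Ideal.mul_mem_right _ _ <| Ideal.mem_map_of_mem _ <|
      coeff_restrictFiber_mem k (fun q hq => (hZ (P, q)).2 ⟨rfl, hq⟩) hf m
  · refine sup_le ?_ ?_
    · rw [Ideal.span_singleton_le_iff_mem, mem_vanishP2]
      intro p hp s t
      rw [MvPolynomial.eval_rename, Sum.elim_comp_inl, ((hZ p).1 hp).1]
      exact hLv s
    · rw [Ideal.map_le_iff_le_comap]
      intro g hg
      rw [Ideal.mem_comap, mem_vanishP2]
      intro p hp s t
      rw [MvPolynomial.eval_rename, Sum.elim_comp_inr]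
      exact (mem_vanishP k).1 hg _ ((hZ p).1 hp).2 t

/-- **Lemma.** Let `X ⊆ ℙ^1 × ℙ^n` be a finite set of points with level sets
`X = X₁ ∪ ⋯ ∪ X_t` (the fibers over `η₁(X)`); suppose the points of `π₁(A_X)` and
`π₁(B_X)` are generic in `ℙ^n`, that `Y_i ∩ Y_j ⊆ B_Y` for `i ≠ j`, and that the last level
set `X_t` (the fiber over a point `P_t ∈ η₁(X)`) satisfies `A_t(X) = X_t ∩ A_X = ∅`.
Then `I_{X_t} = (L_t) + I_W`, where `L_t` is the linear form defining `P_t ∈ ℙ^1` and `I_W`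
is the vanishing ideal of `π₁(B_X) ⊆ ℙ^n` extended to `R`; in particular
`I_{X'} + I_{X_t} ⊇ I_W`, where `X' = X₁ ∪ ⋯ ∪ X_{t-1}` is the union of the other level
sets. -/
theorem last_level_set_ideal [CharZero k] {n : ℕ} (X : Set (Pt k 1 × Pt k n))
    (hfin : X.Finite)
    (Pt' : Pt k 1) (hPt : Pt' ∈ Prod.fst '' X)
    (L : MvPolynomial (Fin (1 + 1)) k) (hL1 : L.IsHomogeneous 1) (hL0 : L ≠ 0)
    (hLv : ∀ s : k, MvPolynomial.eval (s • Pt'.rep) L = 0)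
    (hgen : ∀ Z : Set (Pt k n), Z ⊆ Prod.snd '' AX k X ∪ Prod.snd '' BX k X →
      GenericHF k Z)
    (hint : ∀ P₁ ∈ Prod.fst '' X, ∀ P₂ ∈ Prod.fst '' X, P₁ ≠ P₂ →
      levelImage k X P₁ ∩ levelImage k X P₂ ⊆ BY k X)
    (hAt : {p ∈ X | p.1 = Pt'} ∩ AX k X = ∅) :
    vanishP2 k {p ∈ X | p.1 = Pt'} =
      Ideal.span
          {MvPolynomial.rename (Sum.inl : Fin (1 + 1) → Fin (1 + 1) ⊕ Fin (n + 1)) L} +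
        Ideal.map (MvPolynomial.rename (Sum.inr : Fin (n + 1) → Fin (1 + 1) ⊕ Fin (n + 1)))
          (vanishP k (Prod.snd '' BX k X)) ∧
    Ideal.map (MvPolynomial.rename (Sum.inr : Fin (n + 1) → Fin (1 + 1) ⊕ Fin (n + 1)))
        (vanishP k (Prod.snd '' BX k X)) ≤
      vanishP2 k (X \ {p ∈ X | p.1 = Pt'}) + vanishP2 k {p ∈ X | p.1 = Pt'} := by
  have hZ : ∀ p, p ∈ {p ∈ X | p.1 = Pt'} ↔ p.1 = Pt' ∧ p.2 ∈ Prod.snd '' BX k X := by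
    intro p
    constructor
    · rintro ⟨hpX, hp⟩
      refine ⟨hp, p, ?_, rfl⟩
      by_contra hB
      exact (Set.ext_iff.1 hAt p).1 ⟨⟨hpX, hp⟩, hpX, hB⟩
    · rintro ⟨hp, q, hq, hqp⟩
      refine ⟨?_, hp⟩
      have h := hq.2 Pt' hPt
      rw [hqp, ← hp] at h
      exact h
  have hI := vanishP2_fiber k hZ hL1 hL0 hLv
  refine ⟨hI, ?_⟩
  rw [hI]
  exact le_sup_right.trans le_sup_right

end
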